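/- Let k be an algebraically closed field of characteristic coprime to 6. Let C = {q_C = 0} be a singular reduced plane quartic all of whose singular points have multiplicity 2, and let D = {q_D = 0} be a smooth plane quartic. Then the ideals (H(q_C), K(q_C)) and (H(q_D), K(q_D)) of k[u,v,w] are distinct; in particular the inflection schemes of C and D, cut out in the dual plane by the harmonic quartic and harmonic sextic, do not coincide. -/

import Mathlib

open MvPolynomial

noncomputable section

/-- The classical invariant `S` of a binary quartic form with coefficients `f 0, …, f 4`. -/
def Sinv {R : Type*} [CommRing R] (f : Fin 5 → R) : R :=
  12 * f 0 * f 4 - 3 * f 1 * f 3 + f 2 ^ 2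

/-- The classical invariant `T` of a binary quartic form with coefficients `f 0, …, f 4`. -/
def Tinv {R : Type*} [CommRing R] (f : Fin 5 → R) : R :=
  72 * f 0 * f 2 * f 4 - 27 * f 0 * f 3 ^ 2 - 27 * f 1 ^ 2 * f 4
    + 9 * f 1 * f 2 * f 3 - 2 * f 2 ^ 3

/-- The binary quartic form `f₀ y⁴ + f₁ y³z + f₂ y²z² + f₃ yz³ + f₄ z⁴`. -/
def binQuartic {R : Type*} [CommRing R] (f : Fin 5 → R) : MvPolynomial (Fin 2) R :=
  ∑ i : Fin 5, C (f i) * X 0 ^ (4 - (i : ℕ)) * X 1 ^ (i : ℕ)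

/-- The `i`-th coefficient of a binary quartic form: coefficient of `y^(4-i) z^i`. -/
def binCoeff {R : Type*} [CommRing R] (g : MvPolynomial (Fin 2) R) (i : Fin 5) : R :=
  coeff (Finsupp.single 0 (4 - (i : ℕ)) + Finsupp.single 1 (i : ℕ)) g

/-- The substitution `g(y,z) = q(-v·y - w·z, u·y, u·z)`, a binary quartic form in `y, z` with
coefficients in `R[u,v,w]`. -/
def gsub {R : Type*} [CommRing R] (q : MvPolynomial (Fin 3) R) :
    MvPolynomial (Fin 2) (MvPolynomial (Fin 3) R) :=
  aeval
    (![(C (- X 1) * X 0 - C (X 2) * X 1 : MvPolynomial (Fin 2) (MvPolynomial (Fin 3) R)),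
       C (X 0) * X 0, C (X 0) * X 1]) q

/-- `u⁴ · H(q)`, the invariant `S` of `g(y,z) = q(-vy-wz, uy, uz)`; the harmonic quartic `H(q)`
is the form determined by `u⁴ · H(q) = SG q`. -/
def SG {R : Type*} [CommRing R] (q : MvPolynomial (Fin 3) R) : MvPolynomial (Fin 3) R :=
  Sinv (fun i => binCoeff (gsub q) i)

/-- `u⁶ · K(q)`, the invariant `T` of `g(y,z) = q(-vy-wz, uy, uz)`; the harmonic sextic `K(q)`
is the form determined by `u⁶ · K(q) = TG q`. -/
def TG {R : Type*} [CommRing R] (q : MvPolynomial (Fin 3) R) : MvPolynomial (Fin 3) R :=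
  Tinv (fun i => binCoeff (gsub q) i)

/-- dot product of two vectors in `R³`. -/
def dot3 {R : Type*} [CommRing R] (d a : Fin 3 → R) : R :=
  d 0 * a 0 + d 1 * a 1 + d 2 * a 2

/-- restriction of a ternary form to the parameterized line `(y,z) ↦ y·a + z·b`. -/
def restrictLine {R : Type*} [CommRing R] (q : MvPolynomial (Fin 3) R) (a b : Fin 3 → R) :
    MvPolynomial (Fin 2) R :=
  aeval (fun i => C (a i) * X 0 + C (b i) * X 1) q

/-- A binary quartic form vanishes identically or has a root of multiplicity at least `3`:
`f = L³·M` with `L ≠ 0` linear and `M` linear (possibly zero). -/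
def HasTripleRoot {R : Type*} [CommRing R] (f : MvPolynomial (Fin 2) R) : Prop :=
  ∃ L M : MvPolynomial (Fin 2) R,
    L.IsHomogeneous 1 ∧ M.IsHomogeneous 1 ∧ L ≠ 0 ∧ f = L ^ 3 * M

/-- The line with dual coordinates `d` is an inflection line of the quartic `{q = 0}`. -/
def IsInflectionLine {k : Type*} [Field k] (q : MvPolynomial (Fin 3) k) (d : Fin 3 → k) :
    Prop :=
  d ≠ 0 ∧ ∃ a b : Fin 3 → k, LinearIndependent k ![a, b] ∧
    dot3 d a = 0 ∧ dot3 d b = 0 ∧ HasTripleRoot (restrictLine q a b)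

/-- The line with dual coordinates `d` is a simple inflection line of `{q = 0}` with
inflection point `p`. -/
def IsSimpleInflectionLineAt {k : Type*} [Field k] (q : MvPolynomial (Fin 3) k)
    (d p : Fin 3 → k) : Prop :=
  d ≠ 0 ∧ ∃ (a b : Fin 3 → k) (s t : k), LinearIndependent k ![a, b] ∧
    dot3 d a = 0 ∧ dot3 d b = 0 ∧ (s, t) ≠ (0, 0) ∧
    (∀ i, p i = s * a i + t * b i) ∧
    eval p q = 0 ∧ (∃ i, eval p (pderiv i q) ≠ 0) ∧
    ∃ L M : MvPolynomial (Fin 2) k, L.IsHomogeneous 1 ∧ M.IsHomogeneous 1 ∧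
      LinearIndependent k ![L, M] ∧
      restrictLine q a b = L ^ 3 * M ∧ eval ![s, t] L = 0

/-- The line with dual coordinates `d` is a hyperinflection line of `{q = 0}` with
hyperinflection point `p`. -/
def IsHyperinflectionLineAt {k : Type*} [Field k] (q : MvPolynomial (Fin 3) k)
    (d p : Fin 3 → k) : Prop :=
  d ≠ 0 ∧ ∃ (a b : Fin 3 → k) (s t : k), LinearIndependent k ![a, b] ∧
    dot3 d a = 0 ∧ dot3 d b = 0 ∧ (s, t) ≠ (0, 0) ∧
    (∀ i, p i = s * a i + t * b i) ∧
    eval p q = 0 ∧ (∃ i, eval p (pderiv i q) ≠ 0) ∧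
    ∃ (c : k) (L : MvPolynomial (Fin 2) k), c ≠ 0 ∧ L.IsHomogeneous 1 ∧ L ≠ 0 ∧
      restrictLine q a b = C c * L ^ 4 ∧ eval ![s, t] L = 0

/-- The pairing `⟨·,·⟩` between quartic forms in `x,y,z` and quartic forms in `u,v,w`:
`⟨x^i y^j z^k, u^i v^j w^k⟩ = i!j!k!/2`. -/
def pairQ {R : Type*} [CommRing R] (q h : MvPolynomial (Fin 3) R) : R :=
  ∑ m ∈ q.support,
    (((m 0).factorial * (m 1).factorial * (m 2).factorial / 2 : ℕ) : R)
      * coeff m q * coeff m h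

/-- The action of `Σ c_{ξη} ξ ∂_η ∈ 𝔤𝔩₃(R)` on polynomials. -/
def lieAct {R : Type*} [CommRing R] (c : Fin 3 → Fin 3 → R)
    (q : MvPolynomial (Fin 3) R) : MvPolynomial (Fin 3) R :=
  ∑ ξ : Fin 3, ∑ η : Fin 3, C (c ξ η) * (X ξ * pderiv η q)

/-- substitution of variables by the linear change of coordinates `M`: `q(M·(x,y,z)ᵗ)`. -/
def substM {R : Type*} [CommRing R] (M : Matrix (Fin 3) (Fin 3) R)
    (q : MvPolynomial (Fin 3) R) : MvPolynomial (Fin 3) R :=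
  aeval (fun i => ∑ j : Fin 3, C (M i j) * X j) q

/-- The quartic form `q_ε = (x−y)⁴ + (x−z)⁴ + (y−εz)⁴ − (x⁴ + y⁴ + z⁴)`. -/
def qeps {k : Type*} [CommRing k] (ε : k) : MvPolynomial (Fin 3) k :=
  (X 0 - X 1) ^ 4 + (X 0 - X 2) ^ 4 + (X 1 - C ε * X 2) ^ 4
    - (X 0 ^ 4 + X 1 ^ 4 + X 2 ^ 4)

section helpers

variable {k : Type*} [Field k] {A : Type*} [CommRing A] [Algebra k A]

/-- restriction to a line with coefficients in an algebra -/
def rl (q : MvPolynomial (Fin 3) k) (a b : Fin 3 → A) : MvPolynomial (Fin 2) A :=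
  aeval (fun i => C (a i) * X 0 + C (b i) * X 1) q

/-- coefficients of the restriction -/
def cf (q : MvPolynomial (Fin 3) k) (a b : Fin 3 → A) (i : Fin 5) : A :=
  binCoeff (rl q a b) i

theorem binQuartic_eq_monomial {R : Type*} [CommRing R] (f : Fin 5 → R) :
    binQuartic f = ∑ i : Fin 5,
      monomial (Finsupp.single 0 (4 - (i : ℕ)) + Finsupp.single 1 (i : ℕ)) (f i) := by
  unfold binQuartic
  refine Finset.sum_congr rfl fun i _ => ?_
  rw [X_pow_eq_monomial, X_pow_eq_monomial, C_mul_monomial, monomial_mul]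
  simp

theorem expo_inj (i j : Fin 5)
    (h : (Finsupp.single (0 : Fin 2) (4 - (i : ℕ)) + Finsupp.single 1 (i : ℕ))
      = Finsupp.single 0 (4 - (j : ℕ)) + Finsupp.single 1 (j : ℕ)) : i = j := by
  have := DFunLike.congr_fun h 1
  simp at this
  exact Fin.ext this

theorem binCoeff_binQuartic {R : Type*} [CommRing R] (f : Fin 5 → R) (i : Fin 5) :
    binCoeff (binQuartic f) i = f i := by
  rw [binQuartic_eq_monomial, binCoeff, coeff_sum, Finset.sum_eq_single i]
  · simp
  · intro j _ hj
    rw [coeff_monomial, if_neg]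
    exact fun h => hj (expo_inj _ _ h)
  · simp

theorem eq_binQuartic {R : Type*} [CommRing R] {G : MvPolynomial (Fin 2) R}
    (hG : G.IsHomogeneous 4) : G = binQuartic (binCoeff G) := by
  ext m
  by_cases hm : m 0 + m 1 = 4
  · have hm1 : m 1 < 5 := by omega
    have : m = Finsupp.single 0 (4 - ((⟨m 1, hm1⟩ : Fin 5) : ℕ))
        + Finsupp.single 1 ((⟨m 1, hm1⟩ : Fin 5) : ℕ) := by
      ext j
      fin_cases j
      · simp; omega
      · simp
    conv_rhs => rw [this]
    have h2 := binCoeff_binQuartic (binCoeff G) ⟨m 1, hm1⟩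
    rw [binCoeff] at h2
    rw [h2, binCoeff, ← this]
  · rw [hG.coeff_eq_zero, binQuartic_eq_monomial, coeff_sum, Finset.sum_eq_zero]
    · intro j _
      rw [coeff_monomial, if_neg]
      rintro rfl
      apply hm
      simp
      omega
    · intro h
      apply hm
      rw [← h, Finsupp.degree_eq_sum]
      simp

theorem rl_hom {q : MvPolynomial (Fin 3) k} (hq : q.IsHomogeneous 4) (a b : Fin 3 → A) :
    (rl q a b).IsHomogeneous 4 := by
  have := hq.aeval (n := 1) (fun i => (C (a i) * X 0 + C (b i) * X 1 : MvPolynomial (Fin 2) A))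
    (fun i => by
      apply IsHomogeneous.add
      · simpa using (isHomogeneous_C (Fin 2) (a i)).mul (isHomogeneous_X A (0 : Fin 2))
      · simpa using (isHomogeneous_C (Fin 2) (b i)).mul (isHomogeneous_X A (1 : Fin 2)))
  simpa [rl] using this

theorem rl_eq {q : MvPolynomial (Fin 3) k} (hq : q.IsHomogeneous 4) (a b : Fin 3 → A) :
    rl q a b = binQuartic (cf q a b) := eq_binQuartic (rl_hom hq a b)

theorem cf_map {B : Type*} [CommRing B] [Algebra k B] (φ : A →ₐ[k] B)
    (q : MvPolynomial (Fin 3) k) (a b : Fin 3 → A) (i : Fin 5) :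
    cf q (fun j => φ (a j)) (fun j => φ (b j)) i = φ (cf q a b i) := by
  have : rl q (fun j => φ (a j)) (fun j => φ (b j)) = mapAlgHom φ (rl q a b) := by
    unfold rl
    rw [comp_aeval_apply]
    simp
  rw [cf, cf, this, binCoeff, binCoeff]
  simp [coeff_map]

theorem aeval_line {q : MvPolynomial (Fin 3) k} (hq : q.IsHomogeneous 4) (a b : Fin 3 → A)
    (y z : A) : aeval (fun i => a i * y + b i * z) q =
      cf q a b 0 * y ^ 4 + cf q a b 1 * y ^ 3 * z + cf q a b 2 * y ^ 2 * z ^ 2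
        + cf q a b 3 * y * z ^ 3 + cf q a b 4 * z ^ 4 := by
  have h : ((aeval ![y, z] : MvPolynomial (Fin 2) A →ₐ[A] A).restrictScalars k) (rl q a b)
      = aeval (fun i => a i * y + b i * z) q := by
    unfold rl
    rw [comp_aeval_apply]
    simp
  rw [← h, rl_eq hq]
  simp [binQuartic, Fin.sum_univ_five]

/-- chain rule -/
theorem chain {B : Type*} [CommRing B] [Algebra k B] (D : Derivation k B B)
    (g : Fin 3 → B) (q : MvPolynomial (Fin 3) k) :
    D (aeval g q) = ∑ j, aeval g (pderiv j q) * D (g j) := by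
  induction q using MvPolynomial.induction_on with
  | C c => simp
  | add p q hp hq => simp [hp, hq, add_mul, Finset.sum_add_distrib]
  | mul_X p n hp =>
    simp only [map_mul, aeval_X, Derivation.leibniz, hp, smul_eq_mul, pderiv_X, map_add]
    simp only [add_mul, Finset.sum_add_distrib, Finset.mul_sum]
    congr 1
    · rw [Finset.sum_eq_single n]
      · simp
      · intro j _ hj; simp [hj.symm]
      · simp
    · refine Finset.sum_congr rfl fun j _ => by ring

theorem cf_four {q : MvPolynomial (Fin 3) k} (hq : q.IsHomogeneous 4) (a b : Fin 3 → A) :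
    cf q a b 4 = aeval b q := by
  have := aeval_line hq a b 0 1
  simpa using this.symm

theorem cf_zero {q : MvPolynomial (Fin 3) k} (hq : q.IsHomogeneous 4) (a b : Fin 3 → A) :
    cf q a b 0 = aeval a q := by
  have := aeval_line hq a b 1 0
  simpa using this.symm

/-- substitution in the line parameter -/
theorem cf_subst {q : MvPolynomial (Fin 3) k} (hq : q.IsHomogeneous 4) (a b : Fin 3 → A)
    (α β γ δ : A) : cf q (fun i => a i * α + b i * β) (fun i => a i * γ + b i * δ) =
    (fun f : Fin 5 → A =>
    ![f 0 * α ^ 4 + f 1 * α ^ 3 * β + f 2 * α ^ 2 * β ^ 2 + f 3 * α * β ^ 3 + f 4 * β ^ 4,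
      f 0 * (4 * α ^ 3 * γ) + f 1 * (3 * α ^ 2 * γ * β + α ^ 3 * δ)
        + f 2 * (2 * α * γ * β ^ 2 + 2 * α ^ 2 * β * δ)
        + f 3 * (γ * β ^ 3 + 3 * α * β ^ 2 * δ) + f 4 * (4 * β ^ 3 * δ),
      f 0 * (6 * α ^ 2 * γ ^ 2) + f 1 * (3 * α * γ ^ 2 * β + 3 * α ^ 2 * γ * δ)
        + f 2 * (γ ^ 2 * β ^ 2 + 4 * α * γ * β * δ + α ^ 2 * δ ^ 2)
        + f 3 * (3 * γ * β ^ 2 * δ + 3 * α * β * δ ^ 2) + f 4 * (6 * β ^ 2 * δ ^ 2),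
      f 0 * (4 * α * γ ^ 3) + f 1 * (γ ^ 3 * β + 3 * α * γ ^ 2 * δ)
        + f 2 * (2 * γ ^ 2 * β * δ + 2 * α * γ * δ ^ 2)
        + f 3 * (3 * γ * β * δ ^ 2 + α * δ ^ 3) + f 4 * (4 * β * δ ^ 3),
      f 0 * γ ^ 4 + f 1 * γ ^ 3 * δ + f 2 * γ ^ 2 * δ ^ 2 + f 3 * γ * δ ^ 3 + f 4 * δ ^ 4]) (cf q a b) := by
  beta_reduce
  have h : rl q (fun i => a i * α + b i * β) (fun i => a i * γ + b i * δ) =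
      ((aeval ![C α * X 0 + C γ * X 1, C β * X 0 + C δ * X 1] :
        MvPolynomial (Fin 2) A →ₐ[A] MvPolynomial (Fin 2) A).restrictScalars k) (rl q a b) := by
    unfold rl
    rw [comp_aeval_apply]
    congr 2
    ext1 i
    simp [algebraMap_eq]
    ring
  funext i
  rw [← binCoeff_binQuartic (![_, _, _, _, _] : Fin 5 → A) i, cf, h, rl_eq hq]
  congr 1
  simp [binQuartic, Fin.sum_univ_five, algebraMap_eq, map_ofNat]
  ring

theorem S_subst {q : MvPolynomial (Fin 3) k} (hq : q.IsHomogeneous 4) (a b : Fin 3 → A)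
    (α β γ δ : A) :
    Sinv (cf q (fun i => a i * α + b i * β) (fun i => a i * γ + b i * δ)) =
      (α * δ - β * γ) ^ 4 * Sinv (cf q a b) := by
  rw [cf_subst hq]
  simp [Sinv]
  ring

theorem T_subst {q : MvPolynomial (Fin 3) k} (hq : q.IsHomogeneous 4) (a b : Fin 3 → A)
    (α β γ δ : A) :
    Tinv (cf q (fun i => a i * α + b i * β) (fun i => a i * γ + b i * δ)) =
      (α * δ - β * γ) ^ 6 * Tinv (cf q a b) := by
  rw [cf_subst hq]
  simp [Tinv]
  ring

theorem sub_lemma {R : Type*} [CommRing R] (a b : R) :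
    (C a * X 0 - C b * X 1 : MvPolynomial (Fin 2) R) = C a * X 0 + C (-b) * X 1 := by
  rw [C_neg]
  ring

theorem gsub_eq (q : MvPolynomial (Fin 3) k) :
    gsub q = rl q ![-X 1, X 0, 0] ![-X 2, 0, (X 0 : MvPolynomial (Fin 3) k)] := by
  unfold gsub rl
  congr 2
  ext1 i
  have key : ∀ a b : MvPolynomial (Fin 3) k,
      (C a * X 0 - C b * X 1 : MvPolynomial (Fin 2) (MvPolynomial (Fin 3) k))
        = C a * X 0 + C (-b) * X 1 := fun a b => sub_lemma a b
  have key2 : ∀ a : MvPolynomial (Fin 3) k,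
      (C a * X 0 : MvPolynomial (Fin 2) (MvPolynomial (Fin 3) k))
        = C a * X 0 + C 0 * X 1 := fun a => by rw [C_0, zero_mul, add_zero]
  have key3 : ∀ a : MvPolynomial (Fin 3) k,
      (C a * X 1 : MvPolynomial (Fin 2) (MvPolynomial (Fin 3) k))
        = C 0 * X 0 + C a * X 1 := fun a => by rw [C_0, zero_mul, zero_add]
  fin_cases i
  · exact key _ _
  · exact key2 _
  · exact key3 _

/-- cross product -/
def crs (a b : Fin 3 → A) : Fin 3 → A :=
  ![a 1 * b 2 - a 2 * b 1, a 2 * b 0 - a 0 * b 2, a 0 * b 1 - a 1 * b 0]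

theorem aux_a (φ : MvPolynomial (Fin 3) k →ₐ[k] A) (a b : Fin 3 → A)
    (hφ : ∀ i, φ (X i) = crs a b i) :
    (fun j => φ ((![-X 1, X 0, 0] : Fin 3 → MvPolynomial (Fin 3) k) j))
      = (fun i => a i * b 2 + b i * (- a 2)) := by
  funext i
  fin_cases i <;> simp [hφ, crs] <;> ring

theorem aux_b (φ : MvPolynomial (Fin 3) k →ₐ[k] A) (a b : Fin 3 → A)
    (hφ : ∀ i, φ (X i) = crs a b i) :
    (fun j => φ ((![-X 2, 0, X 0] : Fin 3 → MvPolynomial (Fin 3) k) j))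
      = (fun i => a i * (- b 1) + b i * (a 1)) := by
  funext i
  fin_cases i <;> simp [hφ, crs] <;> ring

theorem S_map {B : Type*} [CommRing B] [Algebra k B] (φ : A →ₐ[k] B)
    (q : MvPolynomial (Fin 3) k) (a b : Fin 3 → A) :
    φ (Sinv (cf q a b)) = Sinv (cf q (fun j => φ (a j)) (fun j => φ (b j))) := by
  simp [Sinv, cf_map, map_ofNat]

theorem T_map {B : Type*} [CommRing B] [Algebra k B] (φ : A →ₐ[k] B)
    (q : MvPolynomial (Fin 3) k) (a b : Fin 3 → A) :
    φ (Tinv (cf q a b)) = Tinv (cf q (fun j => φ (a j)) (fun j => φ (b j))) := by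
  simp [Tinv, cf_map, map_ofNat]

theorem H_dom {q : MvPolynomial (Fin 3) k} (hq : q.IsHomogeneous 4) [IsDomain A]
    {H : MvPolynomial (Fin 3) k} (hH : X 0 ^ 4 * H = SG q) (a b : Fin 3 → A)
    (h0 : crs a b 0 ≠ 0) : aeval (crs a b) H = Sinv (cf q a b) := by
  have h := congrArg (aeval (crs a b)) hH
  have e : SG q = Sinv (cf q ![-X 1, X 0, 0] ![-X 2, 0, (X 0 : MvPolynomial (Fin 3) k)]) := by
    unfold SG
    rw [gsub_eq]
    rfl
  rw [e, S_map, aux_a _ a b (by simp), aux_b _ a b (by simp), S_subst hq] at h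
  have e2 : b 2 * a 1 - -a 2 * -b 1 = crs a b 0 := by simp [crs]; ring
  rw [e2] at h
  simp only [map_mul, map_pow, aeval_X] at h
  exact mul_left_cancel₀ (pow_ne_zero _ h0) h

theorem K_dom {q : MvPolynomial (Fin 3) k} (hq : q.IsHomogeneous 4) [IsDomain A]
    {H : MvPolynomial (Fin 3) k} (hH : X 0 ^ 6 * H = TG q) (a b : Fin 3 → A)
    (h0 : crs a b 0 ≠ 0) : aeval (crs a b) H = Tinv (cf q a b) := by
  have h := congrArg (aeval (crs a b)) hH
  have e : TG q = Tinv (cf q ![-X 1, X 0, 0] ![-X 2, 0, (X 0 : MvPolynomial (Fin 3) k)]) := by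
    unfold TG
    rw [gsub_eq]
    rfl
  rw [e, T_map, aux_a _ a b (by simp), aux_b _ a b (by simp), T_subst hq] at h
  have e2 : b 2 * a 1 - -a 2 * -b 1 = crs a b 0 := by simp [crs]; ring
  rw [e2] at h
  simp only [map_mul, map_pow, aeval_X] at h
  exact mul_left_cancel₀ (pow_ne_zero _ h0) h

/-- generic vectors -/
def ga (k : Type*) [Field k] : Fin 3 → MvPolynomial (Fin 2 × Fin 3) k := fun i => X (0, i)
/-- generic vectors -/
def gb (k : Type*) [Field k] : Fin 3 → MvPolynomial (Fin 2 × Fin 3) k := fun i => X (1, i)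

theorem gen_ne : crs (ga k) (gb k) 0 ≠ 0 := by
  intro h
  have := congrArg (eval (fun ij : Fin 2 × Fin 3 =>
    if ij = (0, 1) then (1 : k) else if ij = (1, 2) then 1 else 0)) h
  simp [crs, ga, gb] at this

theorem crs_map {B : Type*} [CommRing B] [Algebra k B] (φ : A →ₐ[k] B) (a b : Fin 3 → A) :
    (fun i => φ (crs a b i)) = crs (fun i => φ (a i)) (fun i => φ (b i)) := by
  funext i
  fin_cases i <;> simp [crs]

theorem H_gen {q : MvPolynomial (Fin 3) k} (hq : q.IsHomogeneous 4)
    {H : MvPolynomial (Fin 3) k} (hH : X 0 ^ 4 * H = SG q) (a b : Fin 3 → A) :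
    aeval (crs a b) H = Sinv (cf q a b) := by
  have h := congrArg (aeval (fun ij : Fin 2 × Fin 3 => ![a, b] ij.1 ij.2))
    (H_dom hq hH (ga k) (gb k) gen_ne)
  rw [S_map, comp_aeval_apply, crs_map] at h
  simpa [ga, gb] using h

theorem K_gen {q : MvPolynomial (Fin 3) k} (hq : q.IsHomogeneous 4)
    {H : MvPolynomial (Fin 3) k} (hH : X 0 ^ 6 * H = TG q) (a b : Fin 3 → A) :
    aeval (crs a b) H = Tinv (cf q a b) := by
  have h := congrArg (aeval (fun ij : Fin 2 × Fin 3 => ![a, b] ij.1 ij.2))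
    (K_dom hq hH (ga k) (gb k) gen_ne)
  rw [T_map, comp_aeval_apply, crs_map] at h
  simpa [ga, gb] using h

theorem dline0 {q : MvPolynomial (Fin 3) k} (hq : q.IsHomogeneous 4) (a b : Fin 3 → A)
    (y z : A) : ∑ j, aeval (fun i => a i * y + b i * z) (pderiv j q) * a j =
      4 * cf q a b 0 * y ^ 3 + 3 * cf q a b 1 * y ^ 2 * z + 2 * cf q a b 2 * y * z ^ 2
        + cf q a b 3 * z ^ 3 := by
  have h := chain ((pderiv (0 : Fin 2) : Derivation A (MvPolynomial (Fin 2) A) _).restrictScalars k)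
    (fun i => C (a i) * X 0 + C (b i) * X 1) q
  have e : aeval (fun i => C (a i) * X 0 + C (b i) * X 1) q = binQuartic (cf q a b) := rl_eq hq a b
  rw [e] at h
  have h2 := congrArg ((aeval ![y, z] : MvPolynomial (Fin 2) A →ₐ[A] A).restrictScalars k) h
  rw [map_sum] at h2
  simp only [map_mul, comp_aeval_apply] at h2
  simp [binQuartic, Fin.sum_univ_five, map_ofNat, pderiv_X] at h2
  rw [← h2]
  ring

theorem dline1 {q : MvPolynomial (Fin 3) k} (hq : q.IsHomogeneous 4) (a b : Fin 3 → A)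
    (y z : A) : ∑ j, aeval (fun i => a i * y + b i * z) (pderiv j q) * b j =
      cf q a b 1 * y ^ 3 + 2 * cf q a b 2 * y ^ 2 * z + 3 * cf q a b 3 * y * z ^ 2
        + 4 * cf q a b 4 * z ^ 3 := by
  have h := chain ((pderiv (1 : Fin 2) : Derivation A (MvPolynomial (Fin 2) A) _).restrictScalars k)
    (fun i => C (a i) * X 0 + C (b i) * X 1) q
  have e : aeval (fun i => C (a i) * X 0 + C (b i) * X 1) q = binQuartic (cf q a b) := rl_eq hq a b
  rw [e] at h
  have h2 := congrArg ((aeval ![y, z] : MvPolynomial (Fin 2) A →ₐ[A] A).restrictScalars k) h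
  rw [map_sum] at h2
  simp only [map_mul, comp_aeval_apply] at h2
  simp [binQuartic, Fin.sum_univ_five, map_ofNat, pderiv_X] at h2
  rw [← h2]
  ring

theorem cf_three {q : MvPolynomial (Fin 3) k} (hq : q.IsHomogeneous 4) (a b : Fin 3 → A) :
    cf q a b 3 = ∑ j, aeval b (pderiv j q) * a j := by
  have := dline0 hq a b 0 1
  simpa using this.symm

theorem cf_one {q : MvPolynomial (Fin 3) k} (hq : q.IsHomogeneous 4) (a b : Fin 3 → A) :
    cf q a b 1 = ∑ j, aeval a (pderiv j q) * b j := by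
  have := dline1 hq a b 1 0
  simpa using this.symm

theorem cf_two {q : MvPolynomial (Fin 3) k} (hq : q.IsHomogeneous 4) (a b : Fin 3 → A) :
    2 * cf q a b 2 = ∑ j, (∑ i, aeval b (pderiv i (pderiv j q)) * a i) * a j := by
  have h := dline0 hq (fun i => Polynomial.C (a i)) (fun i => Polynomial.C (b i))
    Polynomial.X 1
  have hc : ∀ i, cf q (fun i => Polynomial.C (a i)) (fun i => Polynomial.C (b i)) i
      = Polynomial.C (cf q a b i) := fun i => cf_map (Polynomial.CAlgHom (R := k) (A := A)) q a b i
  simp only [hc] at h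
  have h2 := congrArg (fun P => Polynomial.eval 0 (Polynomial.derivative P)) h
  have hd : ∀ P : MvPolynomial (Fin 3) k, Polynomial.eval 0 (Polynomial.derivative
      (aeval (fun i => Polynomial.C (a i) * Polynomial.X + Polynomial.C (b i) * 1) P))
      = ∑ j, aeval b (pderiv j P) * a j := by
    intro P
    have h := chain ((Polynomial.derivative' : Derivation A (Polynomial A) _).restrictScalars k)
      (fun i => Polynomial.C (a i) * Polynomial.X + Polynomial.C (b i) * 1) P
    have h2 := congrArg ((Polynomial.aeval 0 : Polynomial A →ₐ[A] A).restrictScalars k) h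
    rw [map_sum] at h2
    simp only [map_mul, comp_aeval_apply] at h2
    simpa [← Polynomial.coe_aeval_eq_eval] using h2
  simp only [Polynomial.derivative_sum, Polynomial.derivative_mul, Polynomial.derivative_C,
    Polynomial.eval_finsetSum, mul_zero, add_zero, Polynomial.eval_mul, hd,
    Polynomial.eval_C] at h2
  rw [h2]
  simp [Polynomial.derivative_pow]

/-- moving line -/
def ln (r s : Fin 3 → k) : Fin 3 → Polynomial k :=
  fun i => Polynomial.C (r i) + Polynomial.X * Polynomial.C (s i)

/-- constant point -/
def pc (p : Fin 3 → k) : Fin 3 → Polynomial k := fun i => Polynomial.C (p i)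

theorem aeval_pc (p : Fin 3 → k) (q : MvPolynomial (Fin 3) k) :
    aeval (pc p) q = Polynomial.C (aeval p q) := by
  have := comp_aeval_apply (Polynomial.CAlgHom (R := k) (A := k)) (f := p) (p := q)
  exact this.symm

theorem cf_eval_zero (q : MvPolynomial (Fin 3) k) (r s p : Fin 3 → k) (i : Fin 5) :
    Polynomial.eval 0 (cf q (ln r s) (pc p) i) = cf q r p i := by
  have := cf_map (Polynomial.aeval (0 : k)) q (ln r s) (pc p) i
  simpa [ln, pc, Polynomial.coe_aeval_eq_eval] using this.symm

/-- first-order coefficient -/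
def dc (q : MvPolynomial (Fin 3) k) (r s p : Fin 3 → k) (i : Fin 5) : k :=
  Polynomial.eval 0 (Polynomial.derivative (cf q (ln r s) (pc p) i))

theorem dc_line {q : MvPolynomial (Fin 3) k} (hq : q.IsHomogeneous 4) (r s p : Fin 3 → k)
    (z : k) : ∑ j, aeval (fun i => r i + p i * z) (pderiv j q) * s j =
      dc q r s p 0 + dc q r s p 1 * z + dc q r s p 2 * z ^ 2 + dc q r s p 3 * z ^ 3
        + dc q r s p 4 * z ^ 4 := by
  have h := aeval_line hq (ln r s) (pc p) 1 (Polynomial.C z)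
  have h1 := chain (Polynomial.derivative' : Derivation k (Polynomial k) _)
      (fun i => ln r s i * 1 + pc p i * Polynomial.C z) q
  rw [h] at h1
  have h2 := congrArg (Polynomial.aeval (0 : k) : Polynomial k →ₐ[k] k) h1
  rw [map_sum] at h2
  simp only [map_mul, comp_aeval_apply] at h2
  simp [Polynomial.coe_aeval_eq_eval, ln, pc, Fin.sum_univ_three, Polynomial.derivative_pow] at h2
  simp [Fin.sum_univ_three, dc]
  linear_combination -h2

theorem dc_zero {q : MvPolynomial (Fin 3) k} (hq : q.IsHomogeneous 4) (r s p : Fin 3 → k) :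
    dc q r s p 0 = ∑ j, aeval r (pderiv j q) * s j := by
  simpa using (dc_line hq r s p 0).symm

theorem cfp_four {q : MvPolynomial (Fin 3) k} (hq : q.IsHomogeneous 4) (r s p : Fin 3 → k) :
    cf q (ln r s) (pc p) 4 = Polynomial.C (cf q r p 4) := by
  rw [cf_four hq, cf_four hq, aeval_pc]

theorem cfp_three {q : MvPolynomial (Fin 3) k} (hq : q.IsHomogeneous 4) (r s p : Fin 3 → k) :
    cf q (ln r s) (pc p) 3 = Polynomial.C (cf q r p 3)
      + Polynomial.X * Polynomial.C (cf q s p 3) := by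
  simp only [cf_three hq, aeval_pc, Fin.sum_univ_three, ln, map_add, map_mul]
  ring

/-- determinant -/
def dt (r s p : Fin 3 → k) : k :=
  r 0 * (s 1 * p 2 - s 2 * p 1) - r 1 * (s 0 * p 2 - s 2 * p 0) + r 2 * (s 0 * p 1 - s 1 * p 0)

theorem dt_zero {r s p : Fin 3 → k} (h : dt r s p ≠ 0) (g : Fin 3 → k)
    (hr : ∑ j, g j * r j = 0) (hs : ∑ j, g j * s j = 0) (hp : ∑ j, g j * p j = 0) (i : Fin 3) :
    g i = 0 := by
  rw [Fin.sum_univ_three] at hr hs hp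
  apply (mul_eq_zero.1 (?_ : dt r s p * g i = 0)).resolve_left h
  unfold dt
  fin_cases i
  · simp only [Fin.zero_eta]
    linear_combination (s 1 * p 2 - s 2 * p 1) * hr + (p 1 * r 2 - p 2 * r 1) * hs
      + (r 1 * s 2 - r 2 * s 1) * hp
  · simp only [Fin.mk_one]
    linear_combination (s 2 * p 0 - s 0 * p 2) * hr + (p 2 * r 0 - p 0 * r 2) * hs
      + (r 2 * s 0 - r 0 * s 2) * hp
  · simp only [Fin.reduceFinMk]
    linear_combination (s 0 * p 1 - s 1 * p 0) * hr + (p 0 * r 1 - p 1 * r 0) * hs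
      + (r 0 * s 1 - r 1 * s 0) * hp

/-- smoothness -/
def Smth (q : MvPolynomial (Fin 3) k) : Prop :=
  ∀ pt : Fin 3 → k, pt ≠ 0 → aeval pt q = 0 → ∃ i, aeval pt (pderiv i q) ≠ 0

theorem smth_false {q : MvPolynomial (Fin 3) k} (hsm : Smth q) {r s p : Fin 3 → k}
    (h : dt r s p ≠ 0) (v : Fin 3 → k) (hv : v ≠ 0) (h0 : aeval v q = 0)
    (hr : ∑ j, aeval v (pderiv j q) * r j = 0) (hs : ∑ j, aeval v (pderiv j q) * s j = 0)
    (hp : ∑ j, aeval v (pderiv j q) * p j = 0) : False := by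
  obtain ⟨i, hi⟩ := hsm v hv h0
  exact hi (dt_zero h (fun j => aeval v (pderiv j q)) hr hs hp i)

theorem cubic_root [IsAlgClosed k] (c0 c1 c2 c3 : k) (h : c3 ≠ 0) :
    ∃ z, c0 + c1 * z + c2 * z ^ 2 + c3 * z ^ 3 = 0 := by
  have hd := Polynomial.degree_cubic (b := c2) (c := c1) (d := c0) h
  obtain ⟨z, hz⟩ := IsAlgClosed.exists_root _ (by rw [hd]; decide)
  refine ⟨z, ?_⟩
  simp at hz
  linear_combination hz

theorem quad_root [IsAlgClosed k] (c0 c1 c2 : k) (h : c2 ≠ 0) :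
    ∃ z, c0 + c1 * z + c2 * z ^ 2 = 0 := by
  have hd := Polynomial.degree_quadratic (b := c1) (c := c0) h
  obtain ⟨z, hz⟩ := IsAlgClosed.exists_root _ (by rw [hd]; decide)
  refine ⟨z, ?_⟩
  simp at hz
  linear_combination hz

theorem p_sing {q : MvPolynomial (Fin 3) k} (hq : q.IsHomogeneous 4) (hsm : Smth q)
    {r s p : Fin 3 → k} (h : dt r s p ≠ 0) (h4 : cf q r p 4 = 0) (hr : cf q r p 3 = 0)
    (hs : cf q s p 3 = 0) : False := by
  refine smth_false hsm h p ?_ ?_ ?_ ?_ ?_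
  · rintro rfl
    apply h
    simp [dt]
  · rw [← cf_four hq r, h4]
  · rw [← cf_three hq, hr]
  · rw [← cf_three hq, hs]
  · have := dline1 hq r p 0 1
    simpa [h4] using this

theorem noline [IsAlgClosed k] {q : MvPolynomial (Fin 3) k} (hq : q.IsHomogeneous 4)
    (hsm : Smth q) {r s p : Fin 3 → k} (h : dt r s p ≠ 0) (h0 : ∀ i, cf q r p i = 0) : False := by
  have d4 : dc q r s p 4 = 0 := by simp [dc, cfp_four hq]
  have d3 : dc q r s p 3 = cf q s p 3 := by simp [dc, cfp_three hq]
  by_cases hc : cf q s p 3 = 0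
  · exact p_sing hq hsm h (h0 4) (h0 3) hc
  · rw [← d3] at hc
    obtain ⟨z, hz⟩ := cubic_root (dc q r s p 0) (dc q r s p 1) (dc q r s p 2) _ hc
    have hl := dc_line hq r s p z
    rw [d4, zero_mul, add_zero, hz] at hl
    have e0 := dline0 hq r p 1 z
    have e1 := dline1 hq r p 1 z
    have e2 := aeval_line hq r p 1 z
    simp only [h0, mul_one, mul_zero, zero_mul, add_zero] at e0 e1 e2
    refine smth_false hsm h _ ?_ e2 e0 hl e1
    intro hv
    apply h
    have hv' : ∀ i, r i = - (p i * z) := fun i => eq_neg_of_add_eq_zero_left (congrFun hv i)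
    simp only [dt, hv']
    ring

theorem triple_depressed (h2 : (2 : k) ≠ 0) (h3 : (3 : k) ≠ 0) (g0 g1 g2 g4 : k) (h4 : g4 ≠ 0)
    (hS : 12 * g0 * g4 + g2 ^ 2 = 0) (hT : 72 * g0 * g2 * g4 - 27 * g1 ^ 2 * g4 - 2 * g2 ^ 3 = 0) :
    ∃ w, g2 + 6 * g4 * w ^ 2 = 0 ∧ g1 + 2 * g2 * w + 4 * g4 * w ^ 3 = 0 ∧
      g0 + g1 * w + g2 * w ^ 2 + g4 * w ^ 4 = 0 := by
  have h12 : (12 : k) ≠ 0 := by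
    have : (12 : k) = 2 * 2 * 3 := by norm_num
    rw [this]; simp [h2, h3]
  have h27 : (27 : k) ≠ 0 := by
    have : (27 : k) = 3 * 3 * 3 := by norm_num
    rw [this]; simp [h3]
  have hT' : 8 * g2 ^ 3 + 27 * g1 ^ 2 * g4 = 0 := by linear_combination 6 * g2 * hS - hT
  by_cases hg : g2 = 0
  · subst hg
    have a0 : g0 = 0 := by simpa [h12, h4] using hS
    have a1 : g1 = 0 := by simpa [h27, h4] using hT'
    exact ⟨0, by simp [a0, a1]⟩
  · obtain ⟨w, hw⟩ : ∃ w, 4 * g2 * w = -3 * g1 := by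
      refine ⟨-3 * g1 / (4 * g2), ?_⟩
      have : (4 : k) ≠ 0 := by
        have : (4 : k) = 2 * 2 := by norm_num
        rw [this]; simp [h2]
      field_simp
    have a2 : g2 + 6 * g4 * w ^ 2 = 0 := by
      have : (2 * 2 * 2) * g2 ^ 2 * (g2 + 6 * g4 * w ^ 2) = 0 := by
        linear_combination hT' + 3 * g4 * (4 * g2 * w - 3 * g1) * hw
      simpa [h2, hg] using this
    have a1 : g1 + 2 * g2 * w + 4 * g4 * w ^ 3 = 0 := by
      have : 3 * (g1 + 2 * g2 * w + 4 * g4 * w ^ 3) = 0 := by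
        linear_combination hw + 2 * w * a2
      simpa [h3] using this
    refine ⟨w, a2, a1, ?_⟩
    have : 12 * g4 * (g0 + g1 * w + g2 * w ^ 2 + g4 * w ^ 4) = 0 := by
      linear_combination hS + 12 * g4 * w * a1 - (g2 + 6 * g4 * w ^ 2) * a2
    simpa [h12, h4] using this

theorem triple (h2 : (2 : k) ≠ 0) (h3 : (3 : k) ≠ 0) (f : Fin 5 → k)
    (hS : Sinv f = 0) (hT : Tinv f = 0) : (f 4 = 0 ∧ f 3 = 0 ∧ f 2 = 0) ∨
    ∃ w, f 2 + 3 * f 3 * w + 6 * f 4 * w ^ 2 = 0 ∧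
      f 1 + 2 * f 2 * w + 3 * f 3 * w ^ 2 + 4 * f 4 * w ^ 3 = 0 ∧
      f 0 + f 1 * w + f 2 * w ^ 2 + f 3 * w ^ 3 + f 4 * w ^ 4 = 0 := by
  unfold Sinv at hS
  unfold Tinv at hT
  by_cases h4 : f 4 = 0
  · rw [h4] at hS hT ⊢
    by_cases h3' : f 3 = 0
    · left
      rw [h3'] at hS
      exact ⟨rfl, h3', by simpa using hS⟩
    · right
      obtain ⟨w, hw⟩ : ∃ w, 3 * f 3 * w = - f 2 := ⟨-f 2 / (3 * f 3), by field_simp⟩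
      have a2 : f 2 + 3 * f 3 * w + 6 * 0 * w ^ 2 = 0 := by linear_combination hw
      have a1 : f 1 + 2 * f 2 * w + 3 * f 3 * w ^ 2 + 4 * 0 * w ^ 3 = 0 := by
        have : 3 * f 3 * (f 1 + 2 * f 2 * w + 3 * f 3 * w ^ 2) = 0 := by
          linear_combination -hS + (3 * f 3 * w + f 2) * hw
        simp [h3, h3'] at this
        linear_combination this
      refine ⟨w, a2, a1, ?_⟩
      have : 3 ^ 3 * f 3 ^ 2 * (f 0 + f 1 * w + f 2 * w ^ 2 + f 3 * w ^ 3) = 0 := by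
        linear_combination -hT + 9 * f 3 * (f 2 + 3 * f 3 * w) * a1
          - (2 * f 2 ^ 2 + 9 * f 3 ^ 2 * w ^ 2 + 9 * f 2 * f 3 * w
          + 3 * f 3 * w * (f 2 + 3 * f 3 * w)) * a2
      simp [h3, h3'] at this
      linear_combination this
  · right
    have h4' : (4 : k) ≠ 0 := by
      have : (4 : k) = 2 * 2 := by norm_num
      rw [this]; simp [h2]
    obtain ⟨u, hu⟩ : ∃ u, f 3 + 4 * f 4 * u = 0 := ⟨-f 3 / (4 * f 4), by field_simp; ring⟩
    have e3 : f 3 = - (4 * f 4 * u) := by linear_combination hu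
    rw [e3] at hS hT ⊢
    obtain ⟨w, b2, b1, b0⟩ := triple_depressed h2 h3
      (f 0 + f 1 * u + f 2 * u ^ 2 - 3 * f 4 * u ^ 4)
      (f 1 + 2 * f 2 * u - 8 * f 4 * u ^ 3)
      (f 2 - 6 * f 4 * u ^ 2) (f 4) h4
      (by linear_combination hS) (by linear_combination hT)
    refine ⟨u + w, ?_, ?_, ?_⟩
    · linear_combination b2
    · linear_combination b1
    · linear_combination b0

theorem X_dvd_two {P : Polynomial k} (h : Polynomial.X ^ 2 ∣ P) :
    Polynomial.eval 0 P = 0 ∧ Polynomial.eval 0 (Polynomial.derivative P) = 0 := by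
  obtain ⟨Q, rfl⟩ := h
  simp

theorem D_case1 [IsAlgClosed k] (h2 : (2 : k) ≠ 0) (h3 : (3 : k) ≠ 0)
    {q : MvPolynomial (Fin 3) k} (hq : q.IsHomogeneous 4)
    (hsm : Smth q) {r s p : Fin 3 → k} (h : dt r s p ≠ 0)
    (hS : Polynomial.X ^ 2 ∣ Sinv (cf q (ln r s) (pc p)))
    (hT : Polynomial.X ^ 2 ∣ Tinv (cf q (ln r s) (pc p)))
    (h0 : cf q r p 0 = 0) (h1 : cf q r p 1 = 0) (h22 : cf q r p 2 = 0) : False := by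
  have hS' := (X_dvd_two hS).2
  have hT' := (X_dvd_two hT).2
  simp [Sinv, Polynomial.derivative_pow, cf_eval_zero, h0, h1, h22] at hS'
  simp [Tinv, Polynomial.derivative_pow, cf_eval_zero, h0, h1, h22] at hT'
  have e0 : Polynomial.eval 0 (Polynomial.derivative (cf q (ln r s) (pc p) 0)) = dc q r s p 0 := rfl
  rw [e0] at hS' hT'
  have h12 : (12 : k) ≠ 0 := by
    have : (12 : k) = 2 * 2 * 3 := by norm_num
    rw [this]; simp [h2, h3]
  have h27 : (27 : k) ≠ 0 := by
    have : (27 : k) = 3 * 3 * 3 := by norm_num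
    rw [this]; simp [h3]
  by_cases hc : dc q r s p 0 = 0
  · refine smth_false hsm h r ?_ ?_ ?_ ?_ ?_
    · rintro rfl
      apply h
      simp [dt]
    · rw [← cf_zero hq r p, h0]
    · have := dline0 hq r p 1 0
      simpa [h0] using this
    · rw [← dc_zero hq r s p, hc]
    · rw [← cf_one hq, h1]
  · have h33 : cf q r p 3 = 0 := by simpa [h27, hc] using hT'
    have h44 : cf q r p 4 = 0 := by simpa [h12, hc, h33] using hS'
    refine noline hq hsm h fun i => ?_
    fin_cases i <;> assumption

theorem D_main [IsAlgClosed k] (h2 : (2 : k) ≠ 0) (h3 : (3 : k) ≠ 0)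
    {q : MvPolynomial (Fin 3) k} (hq : q.IsHomogeneous 4)
    (hsm : Smth q) {r s p : Fin 3 → k} (h : dt r s p ≠ 0)
    (hS : Polynomial.X ^ 2 ∣ Sinv (cf q (ln r s) (pc p)))
    (hT : Polynomial.X ^ 2 ∣ Tinv (cf q (ln r s) (pc p))) :
    cf q r p 4 = 0 ∧ cf q r p 3 = 0 ∧ cf q r p 2 = 0 := by
  have hS0 : Sinv (cf q r p) = 0 := by
    have := (X_dvd_two hS).1
    simpa [Sinv, cf_eval_zero] using this
  have hT0 : Tinv (cf q r p) = 0 := by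
    have := (X_dvd_two hT).1
    simpa [Tinv, cf_eval_zero] using this
  rcases triple h2 h3 _ hS0 hT0 with hh | ⟨w, a2, a1, a0⟩
  · exact hh
  · exfalso
    have el : ln (fun i => r i * 1 + p i * w) s
        = fun i => ln r s i * 1 + pc p i * Polynomial.C w := by
      funext i
      simp [ln, pc]
      ring
    have ep : pc p = fun i => ln r s i * 0 + pc p i * 1 := by
      funext i
      simp
    have ep' : p = fun i => r i * 0 + p i * 1 := by
      funext i
      simp
    have ec := cf_subst hq r p 1 w 0 1
    rw [← ep'] at ec
    have eS : Sinv (cf q (ln (fun i => r i * 1 + p i * w) s) (pc p))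
        = Sinv (cf q (ln r s) (pc p)) := by
      rw [el]
      conv_lhs => rw [ep]
      have := S_subst hq (ln r s) (pc p) 1 (Polynomial.C w) 0 1
      simpa using this
    have eT : Tinv (cf q (ln (fun i => r i * 1 + p i * w) s) (pc p))
        = Tinv (cf q (ln r s) (pc p)) := by
      rw [el]
      conv_lhs => rw [ep]
      have := T_subst hq (ln r s) (pc p) 1 (Polynomial.C w) 0 1
      simpa using this
    refine D_case1 h2 h3 hq hsm (r := fun i => r i * 1 + p i * w) (s := s) (p := p) ?_
      (by rw [eS]; exact hS) (by rw [eT]; exact hT) ?_ ?_ ?_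
    · have : dt (fun i => r i * 1 + p i * w) s p = dt r s p := by
        simp only [dt]; ring
      rwa [this]
    · rw [ec]; simp; linear_combination a0
    · rw [ec]; simp; linear_combination a1
    · rw [ec]; simp; linear_combination a2

theorem D_case2 [IsAlgClosed k] (h2 : (2 : k) ≠ 0) (h3 : (3 : k) ≠ 0)
    {q : MvPolynomial (Fin 3) k} (hq : q.IsHomogeneous 4)
    (hsm : Smth q) {r s p : Fin 3 → k} (h : dt r s p ≠ 0)
    (hS : Polynomial.X ^ 2 ∣ Sinv (cf q (ln r s) (pc p)))
    (hT : Polynomial.X ^ 3 ∣ Tinv (cf q (ln r s) (pc p))) : False := by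
  obtain ⟨h44, h33, h22⟩ := D_main h2 h3 hq hsm h hS ((pow_dvd_pow _ (by norm_num)).trans hT)
  by_cases hα : cf q s p 3 = 0
  · exact p_sing hq hsm h h44 h33 hα
  have e4 : cf q (ln r s) (pc p) 4 = 0 := by rw [cfp_four hq, h44]; simp
  have e3 : cf q (ln r s) (pc p) 3 = Polynomial.X * Polynomial.C (cf q s p 3) := by
    rw [cfp_three hq, h33]; simp
  obtain ⟨G, hG⟩ : Polynomial.X ∣ cf q (ln r s) (pc p) 2 := by
    rw [Polynomial.X_dvd_iff, Polynomial.coeff_zero_eq_eval_zero, cf_eval_zero, h22]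
  have h27 : (27 : k) ≠ 0 := by
    have : (27 : k) = 3 * 3 * 3 := by norm_num
    rw [this]; simp [h3]
  have hS' := (X_dvd_two hS).2
  simp [Sinv, Polynomial.derivative_pow, cf_eval_zero, e4, e3, hG] at hS'
  have h11 : cf q r p 1 = 0 := by simpa [h3, hα] using hS'
  obtain ⟨Q, hQ⟩ := hT
  have hT2 : -27 * cf q (ln r s) (pc p) 0 * Polynomial.C (cf q s p 3) ^ 2
      + 9 * cf q (ln r s) (pc p) 1 * G * Polynomial.C (cf q s p 3) - 2 * Polynomial.X * G ^ 3
      = Polynomial.X * Q := by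
    apply mul_left_cancel₀ (pow_ne_zero 2 (Polynomial.X_ne_zero (R := k)))
    rw [Tinv, e4, e3, hG] at hQ
    linear_combination hQ
  have hT3 := congrArg (Polynomial.eval 0) hT2
  simp [cf_eval_zero, h11] at hT3
  have h00 : cf q r p 0 = 0 := by simpa [h27, hα] using hT3
  refine noline hq hsm h fun i => ?_
  clear hT3 hT2 hQ hS' hG e3 e4 hS
  fin_cases i <;> assumption

theorem quadP (h2 : (2 : k) ≠ 0) {q : MvPolynomial (Fin 3) k} (hq : q.IsHomogeneous 4)
    (r s p : Fin 3 → k) : ∃ M, cf q (ln r s) (pc p) 2 = Polynomial.C (cf q r p 2)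
      + Polynomial.X * Polynomial.C M + Polynomial.X ^ 2 * Polynomial.C (cf q s p 2) := by
  refine ⟨(∑ j, ((∑ i, aeval p (pderiv i (pderiv j q)) * r i) * s j
    + (∑ i, aeval p (pderiv i (pderiv j q)) * s i) * r j)) / 2, ?_⟩
  set M := (∑ j, ((∑ i, aeval p (pderiv i (pderiv j q)) * r i) * s j
    + (∑ i, aeval p (pderiv i (pderiv j q)) * s i) * r j)) / 2 with hM
  have hM2 : (∑ j, ((∑ i, aeval p (pderiv i (pderiv j q)) * r i) * s j
    + (∑ i, aeval p (pderiv i (pderiv j q)) * s i) * r j)) = 2 * M := by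
    rw [hM]; field_simp
  have e := cf_two hq (ln r s) (pc p)
  have er := congrArg Polynomial.C (cf_two hq r p)
  have es := congrArg Polynomial.C (cf_two hq s p)
  have eM := congrArg Polynomial.C hM2
  clear_value M
  have h2' : (2 : Polynomial k) ≠ 0 := by
    intro h
    apply h2
    have := congrArg (Polynomial.eval 0) h
    simpa using this
  apply mul_left_cancel₀ h2'
  rw [e]
  simp only [Fin.sum_univ_three, aeval_pc, ln, map_add, map_mul, Polynomial.C_ofNat] at er es eM ⊢
  linear_combination -er - Polynomial.X ^ 2 * es + Polynomial.X * eM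

theorem quad_eval (q : MvPolynomial (Fin 3) k) {r s p : Fin 3 → k}
    {M : k} (h : cf q (ln r s) (pc p) 2 = Polynomial.C (cf q r p 2)
      + Polynomial.X * Polynomial.C M + Polynomial.X ^ 2 * Polynomial.C (cf q s p 2)) (t : k) :
    cf q (fun i => r i + t * s i) p 2 = cf q r p 2 + t * M + t ^ 2 * cf q s p 2 := by
  have h1 := cf_map (Polynomial.aeval (t : k)) q (ln r s) (pc p) 2
  have e1 : (fun j => Polynomial.aeval t (ln r s j)) = fun i => r i + t * s i := by
    funext i
    simp [ln]
    ring
  have e2 : (fun j => Polynomial.aeval t (pc p j)) = p := by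
    funext i
    simp [pc]
  rw [e1, e2, h] at h1
  have e3 : ∀ a b c : k, Polynomial.aeval t (Polynomial.C a + Polynomial.X * Polynomial.C b
      + Polynomial.X ^ 2 * Polynomial.C c) = a + t * b + t ^ 2 * c := by
    intro a b c
    simp
    ring
  rw [e3] at h1
  exact h1

theorem pderiv_swap (i j : Fin 3) (q : MvPolynomial (Fin 3) k) :
    pderiv i (pderiv j q) = pderiv j (pderiv i q) := by
  have h : ⁅(pderiv i : Derivation k (MvPolynomial (Fin 3) k) (MvPolynomial (Fin 3) k)),
      (pderiv j : Derivation k (MvPolynomial (Fin 3) k) (MvPolynomial (Fin 3) k))⁆ = 0 := by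
    apply MvPolynomial.derivation_ext
    intro l
    rw [Derivation.commutator_apply]
    simp only [pderiv_X, Pi.single_apply, Derivation.coe_zero, Pi.zero_apply]
    split_ifs <;> simp
  have h1 := congrArg (fun D => D q) h
  simp only [Derivation.commutator_apply, Derivation.coe_zero, Pi.zero_apply] at h1
  exact sub_eq_zero.1 h1

theorem exists_N (h2 : (2 : k) ≠ 0) {q : MvPolynomial (Fin 3) k} (hq : q.IsHomogeneous 4)
    (p : Fin 3 → k) (h : ∃ i j, aeval p (pderiv i (pderiv j q)) ≠ 0) :
    ∃ v, cf q v p 2 ≠ 0 := by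
  by_contra! hN
  obtain ⟨i, j, hij⟩ := h
  have hs : ∀ i j, aeval p (pderiv i (pderiv j q)) = aeval p (pderiv j (pderiv i q)) :=
    fun i j => by rw [pderiv_swap]
  have hall : ∀ v : Fin 3 → k, ∑ j, (∑ i, aeval p (pderiv i (pderiv j q)) * v i) * v j = 0 := by
    intro v
    rw [← cf_two hq v p, hN, mul_zero]
  generalize hg : (fun i j => aeval p (pderiv i (pderiv j q))) = g at *
  have hg' : ∀ i j, aeval p (pderiv i (pderiv j q)) = g i j := fun i j => by rw [← hg]
  simp only [hg', Fin.sum_univ_three] at hs hall hij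
  apply hij
  have a0 := hall ![1, 0, 0]
  have a1 := hall ![0, 1, 0]
  have a2 := hall ![0, 0, 1]
  have a01 := hall ![1, 1, 0]
  have a02 := hall ![1, 0, 1]
  have a12 := hall ![0, 1, 1]
  simp at a0 a1 a2 a01 a02 a12
  have b01 : g 0 1 = 0 := by
    have : 2 * g 0 1 = 0 := by linear_combination a01 - a0 - a1 + hs 0 1
    simpa [h2] using this
  have b02 : g 0 2 = 0 := by
    have : 2 * g 0 2 = 0 := by linear_combination a02 - a0 - a2 + hs 0 2
    simpa [h2] using this
  have b12 : g 1 2 = 0 := by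
    have : 2 * g 1 2 = 0 := by linear_combination a12 - a1 - a2 + hs 1 2
    simpa [h2] using this
  have b10 := (hs 1 0).trans b01
  have b20 := (hs 2 0).trans b02
  have b21 := (hs 2 1).trans b12
  fin_cases i <;> fin_cases j <;> assumption

theorem exists_dt (h2 : (2 : k) ≠ 0) {q : MvPolynomial (Fin 3) k} (hq : q.IsHomogeneous 4)
    {p s : Fin 3 → k} (hp : p ≠ 0) (h0 : aeval p q = 0) (h1 : ∀ i, aeval p (pderiv i q) = 0)
    (hs : cf q s p 2 ≠ 0) : ∃ r, dt r s p ≠ 0 := by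
  by_contra! hd
  apply hs
  have a0 := hd ![1, 0, 0]
  have a1 := hd ![0, 1, 0]
  have a2 := hd ![0, 0, 1]
  simp [dt] at a0 a1 a2
  obtain ⟨i, hi⟩ := Function.ne_iff.1 hp
  have hi : p i ≠ 0 := hi
  have hsp : ∀ j, s j = p j * (s i / p i) := by
    intro j
    field_simp
    fin_cases i <;> fin_cases j <;> simp <;> grind
  have es : s = fun j => (0 : Fin 3 → k) j * 1 + p j * (s i / p i) := by
    funext j
    rw [hsp j]
    simp
  have ep : p = fun i => (0 : Fin 3 → k) i * 0 + p i * 1 := by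
    funext j
    simp
  have ec := cf_subst hq (0 : Fin 3 → k) p 1 (s i / p i) 0 1
  rw [← ep, ← es] at ec
  rw [ec]
  have f3 : cf q (0 : Fin 3 → k) p 3 = 0 := by rw [cf_three hq]; simp
  have f4 : cf q (0 : Fin 3 → k) p 4 = 0 := by rw [cf_four hq, h0]
  have f2 : cf q (0 : Fin 3 → k) p 2 = 0 := by
    have := cf_two hq 0 p
    simpa [h2] using this
  simp [f2, f3, f4]

theorem main_aux [IsAlgClosed k] (h2 : (2 : k) ≠ 0) (h3 : (3 : k) ≠ 0)
    {q qD : MvPolynomial (Fin 3) k} (hq : q.IsHomogeneous 4) (hD : qD.IsHomogeneous 4)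
    (hsm : Smth qD) {p : Fin 3 → k} (hp : p ≠ 0) (h0 : aeval p q = 0)
    (h1 : ∀ i, aeval p (pderiv i q) = 0) (hh : ∃ i j, aeval p (pderiv i (pderiv j q)) ≠ 0)
    (hS : ∀ r s, cf q (ln r s) (pc p) 2 ^ 2 ∣ Sinv (cf qD (ln r s) (pc p)))
    (hT : ∀ r s, cf q (ln r s) (pc p) 2 ^ 2 ∣ Tinv (cf qD (ln r s) (pc p))) : False := by
  obtain ⟨s, hs⟩ := exists_N h2 hq p hh
  obtain ⟨r0, hr0⟩ := exists_dt h2 hq hp h0 h1 hs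
  obtain ⟨M0, hM0⟩ := quadP h2 hq r0 s p
  obtain ⟨t0, ht0⟩ := quad_root (cf q r0 p 2) M0 (cf q s p 2) hs
  obtain ⟨r, hr, hd⟩ : ∃ r, cf q r p 2 = 0 ∧ dt r s p ≠ 0 := by
    refine ⟨fun i => r0 i + t0 * s i, ?_, ?_⟩
    · rw [quad_eval q hM0]
      linear_combination ht0
    · have : dt (fun i => r0 i + t0 * s i) s p = dt r0 s p := by simp only [dt]; ring
      rwa [this]
  have hX : ∀ r s, cf q r p 2 = 0 → Polynomial.X ^ 2 ∣ cf q (ln r s) (pc p) 2 ^ 2 := by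
    intro r s hr
    apply pow_dvd_pow_of_dvd
    rw [Polynomial.X_dvd_iff, Polynomial.coeff_zero_eq_eval_zero, cf_eval_zero, hr]
  obtain ⟨M, hM⟩ := quadP h2 hq r s p
  by_cases hM1 : M = 0
  · have hX4 : Polynomial.X ^ 4 ∣ cf q (ln r s) (pc p) 2 ^ 2 := by
      rw [hM, hr, hM1]
      refine ⟨Polynomial.C (cf q s p 2) ^ 2, ?_⟩
      rw [Polynomial.C_0]
      ring
    exact D_case2 h2 h3 hD hsm hd ((hX r s hr).trans (hS r s))
      (((pow_dvd_pow _ (by norm_num)).trans hX4).trans (hT r s))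
  · obtain ⟨t, ht, htM⟩ : ∃ t, t ≠ 0 ∧ M + t * cf q s p 2 = 0 :=
      ⟨-M / cf q s p 2, by simp [hM1, hs], by field_simp; ring⟩
    obtain ⟨r', hr', hd', hd''⟩ : ∃ r', cf q r' p 2 = 0 ∧ dt r r' p ≠ 0 ∧ dt r' r p ≠ 0 := by
      refine ⟨fun i => r i + t * s i, ?_, ?_, ?_⟩
      · rw [quad_eval q hM, hr]
        linear_combination t * htM
      · have : dt r (fun i => r i + t * s i) p = t * dt r s p := by simp only [dt]; ring
        rw [this]
        exact mul_ne_zero ht hd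
      · have : dt (fun i => r i + t * s i) r p = -(t * dt r s p) := by simp only [dt]; ring
        rw [this]
        exact neg_ne_zero.2 (mul_ne_zero ht hd)
    have c1 := D_main h2 h3 hD hsm hd' ((hX r r' hr).trans (hS r r')) ((hX r r' hr).trans (hT r r'))
    have c2 := D_main h2 h3 hD hsm hd'' ((hX r' r hr').trans (hS r' r))
      ((hX r' r hr').trans (hT r' r))
    exact p_sing hD hsm hd' c1.1 c1.2.1 c2.2.1

end helpers

/-- Over an algebraically closed field of characteristic coprime to `6`,
a singular reduced plane quartic all of whose singular points have multiplicity `2` and a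
smooth plane quartic have distinct inflection-scheme ideals `(H, K)` in `k[u,v,w]`. -/
theorem stmt12 {k : Type*} [Field k] [IsAlgClosed k] (h6 : (6 : k) ≠ 0)
    (qC qD : MvPolynomial (Fin 3) k)
    (hC4 : qC.IsHomogeneous 4) (hCred : Squarefree qC)
    (hCsing : ∃ pt : Fin 3 → k, pt ≠ 0 ∧ eval pt qC = 0 ∧
      ∀ i, eval pt (pderiv i qC) = 0)
    (hCmult2 : ∀ pt : Fin 3 → k, pt ≠ 0 → eval pt qC = 0 →
      (∀ i, eval pt (pderiv i qC) = 0) →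
      ∃ i j, eval pt (pderiv i (pderiv j qC)) ≠ 0)
    (hD4 : qD.IsHomogeneous 4) (hD0 : qD ≠ 0)
    (hDsm : ∀ pt : Fin 3 → k, pt ≠ 0 → eval pt qD = 0 →
      ∃ i, eval pt (pderiv i qD) ≠ 0)
    (HC KC HD KD : MvPolynomial (Fin 3) k)
    (hHC : X 0 ^ 4 * HC = SG qC) (hKC : X 0 ^ 6 * KC = TG qC)
    (hHD : X 0 ^ 4 * HD = SG qD) (hKD : X 0 ^ 6 * KD = TG qD) :
    Ideal.span ({HC, KC} : Set (MvPolynomial (Fin 3) k)) ≠ Ideal.span {HD, KD} := by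
  intro hI
  have h2 : (2 : k) ≠ 0 := fun h => h6 (by
    have : (6 : k) = 2 * 3 := by norm_num
    rw [this, h, zero_mul])
  have h3 : (3 : k) ≠ 0 := fun h => h6 (by
    have : (6 : k) = 2 * 3 := by norm_num
    rw [this, h, mul_zero])
  obtain ⟨p, hp, hp0, hp1⟩ := hCsing
  have hh := hCmult2 p hp hp0 hp1
  simp only [← aeval_eq_eval] at hp0 hp1 hh hDsm
  have mem1 : HD ∈ Ideal.span ({HC, KC} : Set (MvPolynomial (Fin 3) k)) := by
    rw [hI]; exact Ideal.subset_span (by simp)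
  have mem2 : KD ∈ Ideal.span ({HC, KC} : Set (MvPolynomial (Fin 3) k)) := by
    rw [hI]; exact Ideal.subset_span (by simp)
  obtain ⟨a1, b1, e1⟩ := Ideal.mem_span_pair.1 mem1
  obtain ⟨a2, b2, e2⟩ := Ideal.mem_span_pair.1 mem2
  have f4 : ∀ r s, cf qC (ln r s) (pc p) 4 = 0 := by
    intro r s
    rw [cf_four hC4, aeval_pc, hp0, Polynomial.C_0]
  have f3 : ∀ r s, cf qC (ln r s) (pc p) 3 = 0 := by
    intro r s
    rw [cf_three hC4]
    simp only [aeval_pc, hp1, Polynomial.C_0, zero_mul, Finset.sum_const_zero]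
  have eS : ∀ r s, aeval (crs (ln r s) (pc p)) HC = cf qC (ln r s) (pc p) 2 ^ 2 := by
    intro r s
    rw [H_gen hC4 hHC, Sinv, f4, f3]
    ring
  have eT : ∀ r s, aeval (crs (ln r s) (pc p)) KC = -2 * cf qC (ln r s) (pc p) 2 ^ 3 := by
    intro r s
    rw [K_gen hC4 hKC, Tinv, f4, f3]
    ring
  refine main_aux h2 h3 hC4 hD4 hDsm hp hp0 hp1 hh ?_ ?_
  · intro r s
    rw [← H_gen hD4 hHD, ← e1, map_add, map_mul, map_mul, eS, eT]
    exact ⟨aeval (crs (ln r s) (pc p)) a1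
      + aeval (crs (ln r s) (pc p)) b1 * (-2 * cf qC (ln r s) (pc p) 2), by ring⟩
  · intro r s
    rw [← K_gen hD4 hKD, ← e2, map_add, map_mul, map_mul, eS, eT]
    exact ⟨aeval (crs (ln r s) (pc p)) a2
      + aeval (crs (ln r s) (pc p)) b2 * (-2 * cf qC (ln r s) (pc p) 2), by ring⟩
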